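/- arXiv:2409.03461 — 2 statements merged into one kernel-verified Lean document; each statement's English description precedes it below -/
import Mathlib

section
/- Let D be a smooth data fidelity function, let A ∈ ℝ^{m×n}, and let f : ℝ^n → ℝ ∪ {+∞} be convex piecewise linear with the affine hull of dom(f) = {x | f(x) < +∞} equal to all of ℝ^n. Then S(b) has at most one element for every b ∈ ℝ^m if and only if for every x ∈ ℝ^n, row(A) ∩ ∂f(x) ≠ ∅ implies n − dim(∂f(x)) ≤ rank(A). -/
noncomputable section

/-- A polyhedral set: a finite intersection of closed halfspaces. -/
def IsPolyhedron {n : ℕ} (P : Set (Fin n → ℝ)) : Prop :=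
  ∃ (k : ℕ) (a : Fin k → (Fin n → ℝ)) (β : Fin k → ℝ),
    P = {x | ∀ i, ∑ j, a i j * x j ≤ β i}

/-- Convex piecewise linear function with values in ℝ ∪ {+∞}: the maximum of finitely
many (at least one) affine functions on a polyhedral set `P`, and `+∞` outside `P`. -/
def IsCPWL {n : ℕ} (f : (Fin n → ℝ) → EReal) : Prop :=
  ∃ (k : ℕ) (v : Fin (k + 1) → (Fin n → ℝ)) (w : Fin (k + 1) → ℝ) (P : Set (Fin n → ℝ)),
    IsPolyhedron P ∧
    (∀ x ∈ P, f x =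
      (((Finset.univ.sup' Finset.univ_nonempty fun i => ∑ j, v i j * x j + w i : ℝ)) : EReal)) ∧
    (∀ x ∉ P, f x = ⊤)

/-- The subdifferential of `f` at `x`:
`{v | f y ≥ f x + ⟨v, y - x⟩ for all y}`, read in ℝ ∪ {+∞}. -/
def subdiff {n : ℕ} (f : (Fin n → ℝ) → EReal) (x : Fin n → ℝ) : Set (Fin n → ℝ) :=
  {v | ∀ y, f x + ((∑ j, v j * (y j - x j) : ℝ) : EReal) ≤ f y}

/-- Dimension of a set: the dimension of the linear span of differences of its elements. -/
def setDim {n : ℕ} (S : Set (Fin n → ℝ)) : ℕ :=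
  Module.finrank ℝ (Submodule.span ℝ {d : Fin n → ℝ | ∃ s ∈ S, ∃ s' ∈ S, d = s - s'})

/-- Row space of a matrix: the range of `Aᵀ`. -/
def rowSpace {m n : ℕ} (A : Matrix (Fin m) (Fin n) ℝ) : Set (Fin n → ℝ) :=
  {v | ∃ z : Fin m → ℝ, v = Matrix.vecMul z A}

/-- Nullity of a matrix: the dimension of its kernel. -/
def nullity {m n : ℕ} (A : Matrix (Fin m) (Fin n) ℝ) : ℕ :=
  Module.finrank ℝ (LinearMap.ker A.mulVecLin)

/-- Solution set `S(b) = argmin_x D(Ax, b) + f(x)` of the regularized regression problem. -/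
def solSet {m n : ℕ} (D : (Fin m → ℝ) → (Fin m → ℝ) → ℝ) (A : Matrix (Fin m) (Fin n) ℝ)
    (f : (Fin n → ℝ) → EReal) (b : Fin m → ℝ) : Set (Fin n → ℝ) :=
  {x | ∀ y, ((D (A.mulVec x) b : ℝ) : EReal) + f x ≤ ((D (A.mulVec y) b : ℝ) : EReal) + f y}

/-- The least squares data fidelity `(1/2)‖z - b‖₂²`. -/
def lsq {m : ℕ} (z b : Fin m → ℝ) : ℝ := (1 / 2) * ∑ i, (z i - b i) ^ 2

/-- Smooth data fidelity: `z ↦ D(z, b)` is strictly convex and differentiable for each `b`,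
with gradient (in the first argument) `g z b`, and `b ↦ g z b = ∇_z D(z, b)` is a bijection
of `ℝ^m` for each `z`. -/
def IsSmoothDataFidelity {m : ℕ} (D : (Fin m → ℝ) → (Fin m → ℝ) → ℝ)
    (g : (Fin m → ℝ) → (Fin m → ℝ) → (Fin m → ℝ)) : Prop :=
  (∀ b, StrictConvexOn ℝ Set.univ fun z => D z b) ∧
  (∀ b, Differentiable ℝ fun z => D z b) ∧
  (∀ z b v, fderiv ℝ (fun z' => D z' b) z v = ∑ i, g z b i * v i) ∧
  (∀ z, Function.Bijective fun b => g z b)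

/-- The **Farkas lemma** for finitely many linear functionals. -/
theorem farkas_finset {V ι : Type*} [AddCommGroup V] [Module ℝ V] (s : Finset ι) :
    ∀ (a : ι → V →ₗ[ℝ] ℝ) (b : V →ₗ[ℝ] ℝ),
      (∀ y, (∀ i ∈ s, a i y ≤ 0) → b y ≤ 0) →
      ∃ c : ι → ℝ, (∀ i, 0 ≤ c i) ∧ ∀ y, b y = ∑ i ∈ s, c i * a i y := by
  classical
  induction s using Finset.induction_on with
  | empty =>
    intro a b h
    refine ⟨0, fun _ => le_rfl, fun y => ?_⟩
    have h1 := h y (by simp)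
    have h2 := h (-y) (by simp)
    simp only [map_neg] at h2
    simp only [Finset.sum_empty]
    linarith
  | insert j s hj ih =>
    intro a b h
    by_cases hs : ∀ y, (∀ i ∈ s, a i y ≤ 0) → b y ≤ 0
    · obtain ⟨c, hc, hb⟩ := ih a b hs
      refine ⟨Function.update c j 0, fun i => ?_, fun y => ?_⟩
      · by_cases hi : i = j
        · simp [hi]
        · simp [hi, hc i]
      · rw [Finset.sum_insert hj, hb y]
        simp only [Function.update_self, zero_mul, zero_add]
        refine Finset.sum_congr rfl fun i hi => ?_
        rw [Function.update_of_ne (ne_of_mem_of_not_mem hi hj)]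
    · push Not at hs
      obtain ⟨z, hz, hbz⟩ := hs
      have hjz : 0 < a j z := by
        by_contra hcon
        push Not at hcon
        refine absurd (h z fun i hi => ?_) (not_le.mpr hbz)
        rcases Finset.mem_insert.mp hi with rfl | hi
        · exact hcon
        · exact hz i hi
      obtain ⟨c, hc, hb⟩ := ih (fun i => a i - (a i z / a j z) • a j)
        (b - (b z / a j z) • a j) (by
          intro y hy
          have key : ∀ φ : V →ₗ[ℝ] ℝ,
              φ (y - (a j y / a j z) • z) = (φ - (φ z / a j z) • a j) y := by
            intro φ
            simp only [map_sub, map_smul, LinearMap.sub_apply, LinearMap.smul_apply, smul_eq_mul]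
            field_simp
          rw [← key]
          refine h _ fun i hi => ?_
          rw [key]
          rcases Finset.mem_insert.mp hi with rfl | hi
          · simp only [LinearMap.sub_apply, LinearMap.smul_apply, smul_eq_mul]
            rw [div_self hjz.ne']
            simp
          · exact hy i hi)
      have hcoef : 0 ≤ (b z - ∑ i ∈ s, c i * a i z) / a j z := by
        refine div_nonneg ?_ hjz.le
        have : ∑ i ∈ s, c i * a i z ≤ 0 :=
          Finset.sum_nonpos fun i hi => mul_nonpos_of_nonneg_of_nonpos (hc i) (hz i hi)
        linarith
      refine ⟨Function.update c j ((b z - ∑ i ∈ s, c i * a i z) / a j z), fun i => ?_,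
        fun y => ?_⟩
      · by_cases hi : i = j
        · subst hi
          simpa using hcoef
        · simp [hi, hc i]
      · rw [Finset.sum_insert hj, Function.update_self]
        have hrest : ∑ i ∈ s, Function.update c j
            ((b z - ∑ i ∈ s, c i * a i z) / a j z) i * a i y = ∑ i ∈ s, c i * a i y :=
          Finset.sum_congr rfl fun i hi => by
            rw [Function.update_of_ne (ne_of_mem_of_not_mem hi hj)]
        rw [hrest]
        have hy := hb y
        simp only [LinearMap.sub_apply, LinearMap.smul_apply, smul_eq_mul, mul_sub,
          Finset.sum_sub_distrib] at hy
        have hsum : ∑ i ∈ s, c i * (a i z / a j z * a j y)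
            = (∑ i ∈ s, c i * a i z) / a j z * a j y := by
          rw [Finset.sum_div, Finset.sum_mul]
          exact Finset.sum_congr rfl fun i _ => by ring
        rw [hsum] at hy
        rw [sub_div, sub_mul]
        linarith

/-- The maximum of finitely many affine functions. -/
def maxAffine {n K : ℕ} (v : Fin (K + 1) → Fin n → ℝ) (w : Fin (K + 1) → ℝ)
    (x : Fin n → ℝ) : ℝ :=
  Finset.univ.sup' Finset.univ_nonempty fun i => v i ⬝ᵥ x + w i

/-- The polyhedron cut out by the inequalities `a i ⬝ᵥ x ≤ β i`. -/
def polyhedron {n k : ℕ} (a : Fin k → Fin n → ℝ) (β : Fin k → ℝ) : Set (Fin n → ℝ) :=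
  {x | ∀ i, a i ⬝ᵥ x ≤ β i}

section Polyhedral

variable {n K k : ℕ} {v : Fin (K + 1) → Fin n → ℝ} {w : Fin (K + 1) → ℝ}
  {a : Fin k → Fin n → ℝ} {β : Fin k → ℝ}

theorem le_maxAffine (i : Fin (K + 1)) (x : Fin n → ℝ) : v i ⬝ᵥ x + w i ≤ maxAffine v w x :=
  Finset.le_sup' (fun i => v i ⬝ᵥ x + w i) (Finset.mem_univ i)

theorem maxAffine_le_iff {x : Fin n → ℝ} {c : ℝ} :
    maxAffine v w x ≤ c ↔ ∀ i, v i ⬝ᵥ x + w i ≤ c := by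
  simp [maxAffine, Finset.sup'_le_iff]

theorem maxAffine_lineMap_le (x y : Fin n → ℝ) {t : ℝ} (h0 : 0 ≤ t) (h1 : t ≤ 1) :
    maxAffine v w (x + t • (y - x)) ≤
      maxAffine v w x + t * (maxAffine v w y - maxAffine v w x) := by
  refine maxAffine_le_iff.mpr fun i => ?_
  have hx := le_maxAffine (v := v) (w := w) i x
  have hy := le_maxAffine (v := v) (w := w) i y
  rw [dotProduct_add, dotProduct_smul, dotProduct_sub, smul_eq_mul]
  nlinarith [mul_le_mul_of_nonneg_left hx (sub_nonneg.mpr h1), mul_le_mul_of_nonneg_left hy h0]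

theorem polyhedron_lineMap_mem {x y : Fin n → ℝ} (hx : x ∈ polyhedron a β)
    (hy : y ∈ polyhedron a β) {t : ℝ} (h0 : 0 ≤ t) (h1 : t ≤ 1) :
    x + t • (y - x) ∈ polyhedron a β := by
  intro i
  rw [dotProduct_add, dotProduct_smul, dotProduct_sub, smul_eq_mul]
  nlinarith [mul_le_mul_of_nonneg_left (hx i) (sub_nonneg.mpr h1),
    mul_le_mul_of_nonneg_left (hy i) h0]

/-- The real form of the subdifferential of `maxAffine v w` restricted to `polyhedron a β`. -/
def realSubdiff (v : Fin (K + 1) → Fin n → ℝ) (w : Fin (K + 1) → ℝ)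
    (a : Fin k → Fin n → ℝ) (β : Fin k → ℝ) (x : Fin n → ℝ) : Set (Fin n → ℝ) :=
  {u | ∀ y ∈ polyhedron a β, maxAffine v w x + u ⬝ᵥ (y - x) ≤ maxAffine v w y}

theorem mem_realSubdiff_of_active {x : Fin n → ℝ} {i : Fin (K + 1)}
    (hi : v i ⬝ᵥ x + w i = maxAffine v w x) : v i ∈ realSubdiff v w a β x := by
  intro y _
  have := le_maxAffine (v := v) (w := w) i y
  rw [dotProduct_sub]
  linarith

theorem add_mem_realSubdiff_of_active {x u : Fin n → ℝ} (hu : u ∈ realSubdiff v w a β x)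
    {j : Fin k} (hj : a j ⬝ᵥ x = β j) : u + a j ∈ realSubdiff v w a β x := by
  intro y hy
  have h1 := hu y hy
  have h2 := hy j
  rw [add_dotProduct, dotProduct_sub (a j)]
  linarith

/-- An affine inequality which is strict at `x`, or non-increasing along `d`, persists for small
positive steps along `d`. -/
theorem eventually_affine_le {p q r : ℝ} (hp : p ≤ r) (hq : p = r → q ≤ 0) :
    ∀ᶠ t : ℝ in nhdsWithin 0 (Set.Ioi 0), p + t * q ≤ r := by
  rcases hp.lt_or_eq with h | h
  · have hc : Filter.Tendsto (fun t : ℝ => p + t * q) (nhdsWithin 0 (Set.Ioi 0)) (nhds p) := by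
      have : ContinuousAt (fun t : ℝ => p + t * q) 0 := by fun_prop
      have h2 := this.tendsto
      simp only [zero_mul, add_zero] at h2
      exact h2.mono_left nhdsWithin_le_nhds
    exact (hc.eventually (gt_mem_nhds h)).mono fun t ht => le_of_lt ht
  · filter_upwards [self_mem_nhdsWithin] with t ht
    have := mul_nonpos_of_nonneg_of_nonpos (le_of_lt (Set.mem_Ioi.mp ht)) (hq h)
    linarith

theorem exists_step {x c d : Fin n → ℝ} (hx : x ∈ polyhedron a β)
    (hv : ∀ i, v i ⬝ᵥ x + w i = maxAffine v w x → (v i - c) ⬝ᵥ d ≤ 0)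
    (ha : ∀ j, a j ⬝ᵥ x = β j → a j ⬝ᵥ d ≤ 0) :
    ∃ t : ℝ, 0 < t ∧ x + t • d ∈ polyhedron a β ∧
      maxAffine v w (x + t • d) ≤ maxAffine v w x + t * (c ⬝ᵥ d) := by
  have h1 : ∀ᶠ t : ℝ in nhdsWithin 0 (Set.Ioi 0), ∀ j, a j ⬝ᵥ x + t * (a j ⬝ᵥ d) ≤ β j :=
    Filter.eventually_all.mpr fun j => eventually_affine_le (hx j) (ha j)
  have h2 : ∀ᶠ t : ℝ in nhdsWithin 0 (Set.Ioi 0), ∀ i,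
      (v i ⬝ᵥ x + w i) + t * ((v i - c) ⬝ᵥ d) ≤ maxAffine v w x :=
    Filter.eventually_all.mpr fun i => eventually_affine_le (le_maxAffine i x) (hv i)
  obtain ⟨t, ⟨h1, h2⟩, ht⟩ := ((h1.and h2).and self_mem_nhdsWithin).exists
  refine ⟨t, ht, fun j => ?_, maxAffine_le_iff.mpr fun i => ?_⟩
  · rw [dotProduct_add, dotProduct_smul, smul_eq_mul]
    exact h1 j
  · have := h2 i
    rw [sub_dotProduct] at this
    rw [dotProduct_add, dotProduct_smul, smul_eq_mul]
    linarith

/-- If `u` is a subgradient at `x` but `u + t • l` is not for any `t > 0`, then the affine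
minorant given by `u` touches the function at a point where `l` is larger than at `x`. -/
theorem exists_contact_of_extreme {x u l : Fin n → ℝ} (hx : x ∈ polyhedron a β)
    (hu : u ∈ realSubdiff v w a β x)
    (hl : ∀ t : ℝ, 0 < t → u + t • l ∉ realSubdiff v w a β x) :
    ∃ y ∈ polyhedron a β, maxAffine v w y = maxAffine v w x + u ⬝ᵥ (y - x) ∧
      0 < l ⬝ᵥ (y - x) := by
  classical
  by_cases hF : ∀ d, (∀ i, v i ⬝ᵥ x + w i = maxAffine v w x → (v i - u) ⬝ᵥ d ≤ 0) →
      (∀ j, a j ⬝ᵥ x = β j → a j ⬝ᵥ d ≤ 0) → l ⬝ᵥ d ≤ 0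
  · exfalso
    let s : Finset (Fin (K + 1) ⊕ Fin k) := Finset.univ.filter
      (Sum.elim (fun i => v i ⬝ᵥ x + w i = maxAffine v w x) (fun j => a j ⬝ᵥ x = β j))
    obtain ⟨c, hc, hlc⟩ := farkas_finset s
      (fun i => dotProductBilin ℝ ℝ (Sum.elim (fun i => v i - u) a i)) (dotProductBilin ℝ ℝ l) (by
        intro y hy
        refine hF y (fun i hi => ?_) (fun j hj => ?_)
        · exact hy (Sum.inl i) (by simp [s, hi])
        · exact hy (Sum.inr j) (by simp [s, hj]))
    have hS : 0 ≤ ∑ i ∈ s, c i := Finset.sum_nonneg fun i _ => hc i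
    have hpos : 0 < 1 + ∑ i ∈ s, c i := by linarith
    refine hl (1 + ∑ i ∈ s, c i)⁻¹ (inv_pos.mpr hpos) fun y hy => ?_
    have h0 := hu y hy
    have hle : l ⬝ᵥ (y - x) ≤
        (∑ i ∈ s, c i) * (maxAffine v w y - maxAffine v w x - u ⬝ᵥ (y - x)) := by
      have h1 := hlc (y - x)
      simp only [dotProductBilin_apply_apply] at h1
      rw [h1, Finset.sum_mul]
      refine Finset.sum_le_sum fun i hi => mul_le_mul_of_nonneg_left ?_ (hc i)
      rcases i with i | j
      · have hi : v i ⬝ᵥ x + w i = maxAffine v w x := by simpa [s] using hi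
        have := le_maxAffine (v := v) (w := w) i y
        simp only [Sum.elim_inl, sub_dotProduct, dotProduct_sub (v i)]
        linarith
      · have hj : a j ⬝ᵥ x = β j := by simpa [s] using hi
        have := hy j
        simp only [Sum.elim_inr, dotProduct_sub (a j)]
        linarith
    rw [add_dotProduct, smul_dotProduct, smul_eq_mul]
    have h2 : (1 + ∑ i ∈ s, c i)⁻¹ * (l ⬝ᵥ (y - x)) ≤
        maxAffine v w y - maxAffine v w x - u ⬝ᵥ (y - x) := by
      rw [inv_mul_le_iff₀ hpos]
      linarith
    linarith
  · push Not at hF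
    obtain ⟨d, hv, ha, hld⟩ := hF
    obtain ⟨t, ht, hmem, hle⟩ := exists_step hx hv ha
    refine ⟨x + t • d, hmem, le_antisymm ?_ (hu _ hmem), ?_⟩
    · simpa using hle
    · simpa using mul_pos ht hld

theorem isClosed_realSubdiff (x : Fin n → ℝ) : IsClosed (realSubdiff v w a β x) := by
  simp only [realSubdiff, Set.ofPred_forall]
  refine isClosed_iInter fun y => isClosed_iInter fun _ => isClosed_le ?_ continuous_const
  simp only [dotProduct]
  fun_prop

/-- If the subgradients at `x` are unbounded in the direction `l`, the domain lies in the halfspace where `l` is maximal at `x`. -/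
theorem dotProduct_nonpos_of_unbounded {x u l : Fin n → ℝ}
    (h : ¬ BddAbove {t : ℝ | u + t • l ∈ realSubdiff v w a β x}) {y : Fin n → ℝ}
    (hy : y ∈ polyhedron a β) : l ⬝ᵥ (y - x) ≤ 0 := by
  by_contra hcon
  push Not at hcon
  refine h ⟨(maxAffine v w y - maxAffine v w x - u ⬝ᵥ (y - x)) / (l ⬝ᵥ (y - x)), fun t ht => ?_⟩
  have := ht y hy
  rw [add_dotProduct, smul_dotProduct, smul_eq_mul] at this
  rw [le_div_iff₀ hcon]
  linarith

theorem exists_extreme_of_bddAbove {x u l : Fin n → ℝ} (hu : u ∈ realSubdiff v w a β x)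
    (h : BddAbove {t : ℝ | u + t • l ∈ realSubdiff v w a β x}) :
    ∃ t : ℝ, u + t • l ∈ realSubdiff v w a β x ∧
      ∀ s : ℝ, 0 < s → (u + t • l) + s • l ∉ realSubdiff v w a β x := by
  have hcl : IsClosed {t : ℝ | u + t • l ∈ realSubdiff v w a β x} :=
    (isClosed_realSubdiff x).preimage (f := fun t : ℝ => u + t • l) (by fun_prop)
  refine ⟨_, hcl.csSup_mem ⟨0, by simpa using hu⟩ h, fun s hs hmem => ?_⟩
  have hle := le_csSup h (a := sSup {t : ℝ | u + t • l ∈ realSubdiff v w a β x} + s) (by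
    simpa [add_smul, add_assoc] using hmem)
  linarith

theorem eq_zero_of_dotProduct_eq_zero (hspan : affineSpan ℝ (polyhedron a β) = ⊤)
    {x l : Fin n → ℝ} (h : ∀ y ∈ polyhedron a β, l ⬝ᵥ (y - x) = 0) : l = 0 := by
  have key : ∀ y, l ⬝ᵥ (y - x) = 0 := by
    intro y
    have hy : y ∈ affineSpan ℝ (polyhedron a β) := by rw [hspan]; trivial
    refine affineSpan_induction (p := fun y => l ⬝ᵥ (y - x) = 0) hy h ?_
    intro c p q r hp hq hr
    simp only [vsub_eq_sub, vadd_eq_add, dotProduct_sub, dotProduct_add, dotProduct_smul,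
      smul_eq_mul] at *
    have h1 : l ⬝ᵥ p = l ⬝ᵥ q := by linarith
    rw [h1]
    linarith
  have := key (x + l)
  rw [add_sub_cancel_left] at this
  exact dotProduct_self_eq_zero.mp this

/-- For a nonzero `l`, moving a subgradient along `± l` ends at a subgradient that is shared with
a point `y` separated from `x` by `l`. -/
theorem exists_contact (hspan : affineSpan ℝ (polyhedron a β) = ⊤)
    {x u l : Fin n → ℝ} (hx : x ∈ polyhedron a β) (hu : u ∈ realSubdiff v w a β x)
    (hl : l ≠ 0) :
    ∃ t : ℝ, u + t • l ∈ realSubdiff v w a β x ∧ ∃ y ∈ polyhedron a β,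
      maxAffine v w y = maxAffine v w x + (u + t • l) ⬝ᵥ (y - x) ∧ l ⬝ᵥ (y - x) ≠ 0 := by
  by_cases h1 : BddAbove {t : ℝ | u + t • l ∈ realSubdiff v w a β x}
  · obtain ⟨t, ht, hext⟩ := exists_extreme_of_bddAbove hu h1
    obtain ⟨y, hy, heq, hpos⟩ := exists_contact_of_extreme hx ht hext
    exact ⟨t, ht, y, hy, heq, hpos.ne'⟩
  by_cases h2 : BddAbove {t : ℝ | u + t • (-l) ∈ realSubdiff v w a β x}
  · obtain ⟨t, ht, hext⟩ := exists_extreme_of_bddAbove hu h2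
    obtain ⟨y, hy, heq, hpos⟩ := exists_contact_of_extreme hx ht hext
    have hneg : t • (-l) = (-t) • l := by simp
    rw [hneg] at ht heq
    refine ⟨-t, ht, y, hy, heq, ?_⟩
    rw [neg_dotProduct] at hpos
    exact (neg_pos.mp hpos).ne
  · refine absurd (eq_zero_of_dotProduct_eq_zero hspan (x := x) fun y hy => ?_) hl
    have e1 := dotProduct_nonpos_of_unbounded h1 hy
    have e2 := dotProduct_nonpos_of_unbounded h2 hy
    rw [neg_dotProduct] at e2
    linarith

/-- At an interior point of a segment on which the function is affine, subgradients are
subgradients at the endpoint and are constant along the segment. -/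
theorem realSubdiff_midpoint {x y u : Fin n → ℝ} (hx : x ∈ polyhedron a β)
    (hy : y ∈ polyhedron a β) (hu : u ∈ realSubdiff v w a β x)
    (heq : maxAffine v w y = maxAffine v w x + u ⬝ᵥ (y - x)) :
    u ∈ realSubdiff v w a β (x + (1 / 2 : ℝ) • (y - x)) ∧
    ∀ p ∈ realSubdiff v w a β (x + (1 / 2 : ℝ) • (y - x)),
      p ∈ realSubdiff v w a β x ∧ p ⬝ᵥ (y - x) = u ⬝ᵥ (y - x) := by
  have hm := polyhedron_lineMap_mem hx hy (t := 1 / 2) (by norm_num) (by norm_num)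
  have hmle := maxAffine_lineMap_le (v := v) (w := w) x y (t := 1 / 2) (by norm_num) (by norm_num)
  have hmge := hu _ hm
  simp only [add_sub_cancel_left, dotProduct_smul, smul_eq_mul] at hmge
  constructor
  · intro z hz
    have := hu z hz
    simp only [dotProduct_sub, dotProduct_add, dotProduct_smul, smul_eq_mul] at *
    linarith
  · intro p hp
    have hpx := hp x hx
    have hpy := hp y hy
    refine ⟨fun z hz => ?_, ?_⟩
    · have := hp z hz
      simp only [dotProduct_sub, dotProduct_add, dotProduct_smul, smul_eq_mul] at *
      linarith
    · simp only [dotProduct_sub, dotProduct_add, dotProduct_smul, smul_eq_mul] at *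
      linarith

end Polyhedral

section LinearAlgebra

variable {n m : ℕ}

/-- The direction of a set: the span of its differences. -/
def diffSpan (S : Set (Fin n → ℝ)) : Submodule ℝ (Fin n → ℝ) :=
  Submodule.span ℝ {d : Fin n → ℝ | ∃ s ∈ S, ∃ s' ∈ S, d = s - s'}

theorem dotProduct_eq_zero_of_mem_diffSpan {S : Set (Fin n → ℝ)} {d l : Fin n → ℝ} {c : ℝ}
    (h : ∀ p ∈ S, p ⬝ᵥ d = c) (hl : l ∈ diffSpan S) : l ⬝ᵥ d = 0 := by
  induction hl using Submodule.span_induction with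
  | mem x hx =>
    obtain ⟨s, hs, s', hs', rfl⟩ := hx
    rw [sub_dotProduct, h s hs, h s' hs', sub_self]
  | zero => simp
  | add x y _ _ hx hy => rw [add_dotProduct, hx, hy, add_zero]
  | smul r x _ hx => rw [smul_dotProduct, hx, smul_zero]

theorem finrank_range_vecMulLinear (A : Matrix (Fin m) (Fin n) ℝ) :
    Module.finrank ℝ (LinearMap.range A.vecMulLinear) = A.rank := by
  rw [← Matrix.rank_transpose A, Matrix.rank, Matrix.mulVecLin_transpose]

theorem mem_rowSpace_iff {A : Matrix (Fin m) (Fin n) ℝ} {u : Fin n → ℝ} :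
    u ∈ rowSpace A ↔ u ∈ LinearMap.range A.vecMulLinear := by
  simp [rowSpace, LinearMap.mem_range, eq_comm]

/-- A proper subspace is annihilated by a nonzero vector. -/
theorem exists_dotProduct_eq_zero {W : Submodule ℝ (Fin n → ℝ)} (hW : W < ⊤) :
    ∃ d : Fin n → ℝ, d ≠ 0 ∧ ∀ l ∈ W, l ⬝ᵥ d = 0 := by
  obtain ⟨φ, hφ, hle⟩ := Submodule.exists_le_ker_of_lt_top W hW
  have hrep : ∀ l, φ l = l ⬝ᵥ fun i => φ (Pi.single i 1) := by
    intro l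
    rw [LinearMap.pi_apply_eq_sum_univ φ l]
    simp only [dotProduct, smul_eq_mul]
    refine Finset.sum_congr rfl fun i _ => ?_
    congr 2
    ext j
    simp [Pi.single_apply, eq_comm]
  refine ⟨fun i => φ (Pi.single i 1), fun h0 => hφ ?_, fun l hl => ?_⟩
  · ext1 i
    ext
    simpa using congrFun h0 i
  · rw [← hrep]
    exact hle hl

/-- Two subspaces annihilated by a common nonzero vector, with complementary dimensions or more,
intersect nontrivially. -/
theorem exists_mem_inf_ne_zero {L R : Submodule ℝ (Fin n → ℝ)} {d : Fin n → ℝ} (hd : d ≠ 0)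
    (hL : ∀ l ∈ L, l ⬝ᵥ d = 0) (hR : ∀ l ∈ R, l ⬝ᵥ d = 0)
    (hdim : n ≤ Module.finrank ℝ L + Module.finrank ℝ R) : ∃ l ∈ L, l ∈ R ∧ l ≠ 0 := by
  by_contra hcon
  push Not at hcon
  have hinf : L ⊓ R = ⊥ := (Submodule.eq_bot_iff _).mpr fun l hl => hcon l hl.1 hl.2
  have h1 := Submodule.finrank_sup_add_finrank_inf_eq L R
  rw [hinf, finrank_bot, add_zero] at h1
  have htop : L ⊔ R = ⊤ := by
    refine Submodule.eq_top_of_finrank_eq (le_antisymm (Submodule.finrank_le _) ?_)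
    rw [h1, Module.finrank_fin_fun]
    exact hdim
  have hdmem : d ∈ L ⊔ R := by rw [htop]; trivial
  obtain ⟨p, hp, q, hq, hpq⟩ := Submodule.mem_sup.mp hdmem
  refine hd (dotProduct_self_eq_zero.mp ?_)
  nth_rewrite 1 [← hpq]
  rw [add_dotProduct, hL p hp, hR q hq, add_zero]

theorem mulVec_eq_zero_of_forall_rowSpace {A : Matrix (Fin m) (Fin n) ℝ} {d : Fin n → ℝ}
    (h : ∀ l ∈ LinearMap.range A.vecMulLinear, l ⬝ᵥ d = 0) : A.mulVec d = 0 := by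
  have := h (Matrix.vecMul (A.mulVec d) A) ⟨_, rfl⟩
  rw [← Matrix.dotProduct_mulVec] at this
  exact dotProduct_self_eq_zero.mp this

end LinearAlgebra

section Descent

variable {n m K k : ℕ} {v : Fin (K + 1) → Fin n → ℝ} {w : Fin (K + 1) → ℝ}
  {a : Fin k → Fin n → ℝ} {β : Fin k → ℝ}

/-- If the subgradients at `x` are constant along a nonzero `d ∈ ker A` and meet the row space,
then the dimension condition fails at some point. -/
theorem exists_rank_lt (hspan : affineSpan ℝ (polyhedron a β) = ⊤)
    (A : Matrix (Fin m) (Fin n) ℝ) {d : Fin n → ℝ} (hd : d ≠ 0) (hAd : A.mulVec d = 0) :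
    ∀ (N : ℕ) (x u : Fin n → ℝ), Module.finrank ℝ (diffSpan (realSubdiff v w a β x)) = N →
      x ∈ polyhedron a β → u ∈ LinearMap.range A.vecMulLinear → u ∈ realSubdiff v w a β x →
      (∀ p ∈ realSubdiff v w a β x, p ⬝ᵥ d = 0) →
      ∃ x ∈ polyhedron a β, (∃ u ∈ LinearMap.range A.vecMulLinear, u ∈ realSubdiff v w a β x) ∧
        Module.finrank ℝ (diffSpan (realSubdiff v w a β x)) + A.rank < n := by
  intro N
  induction N using Nat.strong_induction_on with
  | _ N ih =>
    intro x u hN hx huA hu hdp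
    by_cases hlt : Module.finrank ℝ (diffSpan (realSubdiff v w a β x)) + A.rank < n
    · exact ⟨x, hx, ⟨u, huA, hu⟩, hlt⟩
    push Not at hlt
    obtain ⟨l, hlL, hlR, hl0⟩ := exists_mem_inf_ne_zero hd
      (fun l hl => dotProduct_eq_zero_of_mem_diffSpan hdp hl)
      (R := LinearMap.range A.vecMulLinear) (by
        rintro _ ⟨z, rfl⟩
        rw [Matrix.vecMulLinear_apply, ← Matrix.dotProduct_mulVec, hAd, dotProduct_zero])
      (by rwa [finrank_range_vecMulLinear])
    obtain ⟨t, ht, y, hy, heq, hne⟩ := exists_contact hspan hx hu hl0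
    obtain ⟨hmid, hsub⟩ := realSubdiff_midpoint hx hy ht heq
    have hspan_lt : diffSpan (realSubdiff v w a β (x + (1 / 2 : ℝ) • (y - x))) <
        diffSpan (realSubdiff v w a β x) := by
      refine lt_of_le_of_ne (Submodule.span_mono ?_) fun h => hne ?_
      · rintro _ ⟨s, hs, s', hs', rfl⟩
        exact ⟨s, (hsub s hs).1, s', (hsub s' hs').1, rfl⟩
      · rw [← h] at hlL
        exact dotProduct_eq_zero_of_mem_diffSpan (fun p hp => (hsub p hp).2) hlL
    exact ih _ (hN ▸ Submodule.finrank_lt_finrank_of_lt hspan_lt) _ _ rfl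
      (polyhedron_lineMap_mem hx hy (by norm_num) (by norm_num))
      (Submodule.add_mem _ huA (Submodule.smul_mem _ _ hlR)) hmid
      (fun p hp => hdp p (hsub p hp).1)

/-- If the dimension condition fails at `x`, the function does not increase along some nonzero
step in `ker A`. -/
theorem exists_ne_of_rank_lt (A : Matrix (Fin m) (Fin n) ℝ) {x u : Fin n → ℝ}
    (hx : x ∈ polyhedron a β) (huA : u ∈ LinearMap.range A.vecMulLinear)
    (hu : u ∈ realSubdiff v w a β x)
    (hlt : Module.finrank ℝ (diffSpan (realSubdiff v w a β x)) + A.rank < n) :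
    ∃ y ∈ polyhedron a β, y ≠ x ∧ A.mulVec y = A.mulVec x ∧
      maxAffine v w y ≤ maxAffine v w x := by
  have htop : diffSpan (realSubdiff v w a β x) ⊔ LinearMap.range A.vecMulLinear < ⊤ := by
    refine lt_top_iff_ne_top.mpr fun h => ?_
    have h1 := Submodule.finrank_add_le_finrank_add_finrank
      (diffSpan (realSubdiff v w a β x)) (LinearMap.range A.vecMulLinear)
    rw [h, finrank_top, Module.finrank_fin_fun, finrank_range_vecMulLinear] at h1
    omega
  obtain ⟨d, hd, horth⟩ := exists_dotProduct_eq_zero htop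
  have hR : ∀ l ∈ LinearMap.range A.vecMulLinear, l ⬝ᵥ d = 0 := fun l hl =>
    horth l (Submodule.mem_sup_right hl)
  have hL : ∀ p ∈ realSubdiff v w a β x, p ⬝ᵥ d = 0 := by
    intro p hp
    have := horth (p - u) (Submodule.mem_sup_left (Submodule.subset_span ⟨p, hp, u, hu, rfl⟩))
    rw [sub_dotProduct, hR u huA, sub_zero] at this
    exact this
  obtain ⟨t, ht, hmem, hle⟩ := exists_step (v := v) (w := w) (c := 0) (d := d) hx
    (fun i hi => by rw [sub_zero, hL _ (mem_realSubdiff_of_active hi)])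
    (fun j hj => by
      have := hL _ (add_mem_realSubdiff_of_active hu hj)
      rw [add_dotProduct, hL u hu, zero_add] at this
      exact this.le)
  refine ⟨x + t • d, hmem, ?_, ?_, by simpa using hle⟩
  · simp [ht.ne', hd]
  · rw [Matrix.mulVec_add, Matrix.mulVec_smul, mulVec_eq_zero_of_forall_rowSpace hR, smul_zero,
      add_zero]

end Descent

section DataFidelity

variable {m n : ℕ} {D : (Fin m → ℝ) → (Fin m → ℝ) → ℝ}
  {g : (Fin m → ℝ) → (Fin m → ℝ) → (Fin m → ℝ)}

theorem IsSmoothDataFidelity.tendsto_slope (hD : IsSmoothDataFidelity D g) (b z e : Fin m → ℝ) :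
    Filter.Tendsto (fun t : ℝ => t⁻¹ * (D (z + t • e) b - D z b))
      (nhdsWithin 0 (Set.Ioi 0)) (nhds (g z b ⬝ᵥ e)) := by
  have h1 : HasFDerivAt (fun z' => D z' b) (fderiv ℝ (fun z' => D z' b) z) z :=
    (hD.2.1 b z).hasFDerivAt
  have h2 := (h1.hasLineDerivAt e).tendsto_slope_zero_right
  rw [hD.2.2.1 z b e] at h2
  simpa [dotProduct] using h2

theorem IsSmoothDataFidelity.gradient_le (hD : IsSmoothDataFidelity D g) (b z z' : Fin m → ℝ) :
    D z b + g z b ⬝ᵥ (z' - z) ≤ D z' b := by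
  have h : g z b ⬝ᵥ (z' - z) ≤ D z' b - D z b := by
    refine le_of_tendsto (hD.tendsto_slope b z (z' - z)) ?_
    filter_upwards [Ioo_mem_nhdsGT (zero_lt_one' ℝ)] with t ht
    rw [inv_mul_le_iff₀ ht.1]
    have hc := (hD.1 b).convexOn.2 (Set.mem_univ z) (Set.mem_univ z') (sub_nonneg.mpr ht.2.le)
      ht.1.le (by ring)
    have he : (1 - t) • z + t • z' = z + t • (z' - z) := by module
    simp only [he, smul_eq_mul] at hc
    linarith
  linarith

variable {K k : ℕ} {v : Fin (K + 1) → Fin n → ℝ} {w : Fin (K + 1) → ℝ}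
  {a : Fin k → Fin n → ℝ} {β : Fin k → ℝ}

/-- First-order optimality condition. -/
theorem IsSmoothDataFidelity.neg_vecMul_mem_realSubdiff (hD : IsSmoothDataFidelity D g)
    {A : Matrix (Fin m) (Fin n) ℝ} {b : Fin m → ℝ} {x : Fin n → ℝ} (hx : x ∈ polyhedron a β)
    (hmin : ∀ y ∈ polyhedron a β,
      D (A.mulVec x) b + maxAffine v w x ≤ D (A.mulVec y) b + maxAffine v w y) :
    Matrix.vecMul (-g (A.mulVec x) b) A ∈ realSubdiff v w a β x := by
  intro y hy
  have h : maxAffine v w x - maxAffine v w y ≤ g (A.mulVec x) b ⬝ᵥ A.mulVec (y - x) := by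
    refine ge_of_tendsto (hD.tendsto_slope b (A.mulVec x) (A.mulVec (y - x))) ?_
    filter_upwards [Ioo_mem_nhdsGT (zero_lt_one' ℝ)] with t ht
    rw [le_inv_mul_iff₀ ht.1]
    have h1 := hmin _ (polyhedron_lineMap_mem hx hy ht.1.le ht.2.le)
    have h2 := maxAffine_lineMap_le (v := v) (w := w) x y ht.1.le ht.2.le
    rw [Matrix.mulVec_add, Matrix.mulVec_smul] at h1
    linarith
  rw [← Matrix.dotProduct_mulVec, neg_dotProduct]
  linarith

/-- Two distinct minimizers force a nonzero direction in `ker A` along which the subgradients at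
some minimizer vanish. -/
theorem IsSmoothDataFidelity.midpoint_of_minimizers (hD : IsSmoothDataFidelity D g)
    {A : Matrix (Fin m) (Fin n) ℝ} {b : Fin m → ℝ} {x y : Fin n → ℝ} (hx : x ∈ polyhedron a β)
    (hy : y ∈ polyhedron a β)
    (hxmin : ∀ z ∈ polyhedron a β,
      D (A.mulVec x) b + maxAffine v w x ≤ D (A.mulVec z) b + maxAffine v w z)
    (hymin : ∀ z ∈ polyhedron a β,
      D (A.mulVec y) b + maxAffine v w y ≤ D (A.mulVec z) b + maxAffine v w z) :
    ∃ q ∈ polyhedron a β, A.mulVec (y - x) = 0 ∧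
      Matrix.vecMul (-g (A.mulVec q) b) A ∈ realSubdiff v w a β q ∧
      ∀ p ∈ realSubdiff v w a β q, p ⬝ᵥ (y - x) = 0 := by
  have hm := polyhedron_lineMap_mem hx hy (t := 1 / 2) (by norm_num) (by norm_num)
  have hmle := maxAffine_lineMap_le (v := v) (w := w) x y (t := 1 / 2) (by norm_num) (by norm_num)
  have e1 := hxmin y hy
  have e2 := hymin x hx
  have e3 := hxmin _ hm
  have hA : A.mulVec x = A.mulVec y := by
    by_contra hne
    have hs := (hD.1 b).2 (Set.mem_univ (A.mulVec x)) (Set.mem_univ (A.mulVec y)) hne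
      one_half_pos one_half_pos (add_halves 1)
    have he : (1 / 2 : ℝ) • A.mulVec x + (1 / 2 : ℝ) • A.mulVec y =
        A.mulVec (x + (1 / 2 : ℝ) • (y - x)) := by
      rw [Matrix.mulVec_add, Matrix.mulVec_smul, Matrix.mulVec_sub]
      module
    simp only [he, smul_eq_mul] at hs
    linarith
  have hker : A.mulVec (y - x) = 0 := by rw [Matrix.mulVec_sub, hA, sub_self]
  have hAm : A.mulVec (x + (1 / 2 : ℝ) • (y - x)) = A.mulVec x := by
    rw [Matrix.mulVec_add, Matrix.mulVec_smul, hker, smul_zero, add_zero]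
  rw [hA] at e1 e2
  rw [hAm] at e3
  refine ⟨_, hm, hker, hD.neg_vecMul_mem_realSubdiff hm fun z hz => ?_, fun p hp => ?_⟩
  · have := hxmin z hz
    rw [hAm]
    linarith
  · have h1 := hp x hx
    have h2 := hp y hy
    simp only [dotProduct_sub, dotProduct_add, dotProduct_smul, smul_eq_mul] at *
    linarith

end DataFidelity

section Extended

variable {n m : ℕ} {f : (Fin n → ℝ) → EReal} {F : (Fin n → ℝ) → ℝ} {P : Set (Fin n → ℝ)}

theorem mem_subdiff_iff (hP : ∀ x ∈ P, f x = (F x : EReal)) (hT : ∀ x ∉ P, f x = ⊤)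
    (hne : P.Nonempty) {x u : Fin n → ℝ} :
    u ∈ subdiff f x ↔ x ∈ P ∧ ∀ y ∈ P, F x + u ⬝ᵥ (y - x) ≤ F y := by
  constructor
  · intro h
    have hx : x ∈ P := by
      by_contra hx
      obtain ⟨y, hy⟩ := hne
      have := h y
      rw [hT x hx, hP y hy, EReal.top_add_coe] at this
      exact (EReal.coe_lt_top _).not_ge this
    refine ⟨hx, fun y hy => ?_⟩
    have := h y
    rw [hP x hx, hP y hy] at this
    exact_mod_cast this
  · rintro ⟨hx, h⟩ y
    by_cases hy : y ∈ P
    · rw [hP x hx, hP y hy]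
      exact_mod_cast h y hy
    · rw [hT y hy]
      exact le_top

theorem mem_solSet_iff (hP : ∀ x ∈ P, f x = (F x : EReal)) (hT : ∀ x ∉ P, f x = ⊤)
    (hne : P.Nonempty) {D : (Fin m → ℝ) → (Fin m → ℝ) → ℝ} {A : Matrix (Fin m) (Fin n) ℝ}
    {b : Fin m → ℝ} {x : Fin n → ℝ} :
    x ∈ solSet D A f b ↔
      x ∈ P ∧ ∀ y ∈ P, D (A.mulVec x) b + F x ≤ D (A.mulVec y) b + F y := by
  constructor
  · intro h
    have hx : x ∈ P := by
      by_contra hx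
      obtain ⟨y, hy⟩ := hne
      have := h y
      rw [hT x hx, hP y hy, EReal.coe_add_top, ← EReal.coe_add] at this
      exact (EReal.coe_lt_top _).not_ge this
    refine ⟨hx, fun y hy => ?_⟩
    have := h y
    rw [hP x hx, hP y hy] at this
    exact_mod_cast this
  · rintro ⟨hx, h⟩ y
    by_cases hy : y ∈ P
    · rw [hP x hx, hP y hy]
      exact_mod_cast h y hy
    · rw [hT y hy, EReal.coe_add_top]
      exact le_top

end Extended

/-- Necessary and sufficient conditions for uniqueness (Corollary 3.9). -/
theorem nec_suf_uniqueness {n m : ℕ} (D : (Fin m → ℝ) → (Fin m → ℝ) → ℝ)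
    (g : (Fin m → ℝ) → (Fin m → ℝ) → (Fin m → ℝ)) (hD : IsSmoothDataFidelity D g)
    (A : Matrix (Fin m) (Fin n) ℝ) (f : (Fin n → ℝ) → EReal) (hf : IsCPWL f)
    (hdom : affineSpan ℝ {x : Fin n → ℝ | f x < ⊤} = ⊤) :
    (∀ b : Fin m → ℝ, (solSet D A f b).Subsingleton) ↔
      (∀ x : Fin n → ℝ, (rowSpace A ∩ subdiff f x).Nonempty →
        n - setDim (subdiff f x) ≤ A.rank) := by
  obtain ⟨K, v, w, P, ⟨k, a, β, rfl⟩, hP, hT⟩ := hf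
  change ∀ x ∈ polyhedron a β, f x = (maxAffine v w x : EReal) at hP
  change ∀ x ∉ polyhedron a β, f x = ⊤ at hT
  have hspan : affineSpan ℝ (polyhedron a β) = ⊤ := by
    rw [← hdom]
    congr 1
    ext x
    by_cases hx : x ∈ polyhedron a β
    · simp [hx, hP x hx]
    · simp [hx, hT x hx]
  have hne : (polyhedron a β).Nonempty := by
    rw [← affineSpan_nonempty ℝ, hspan]
    exact ⟨0, trivial⟩
  have hsub : ∀ x ∈ polyhedron a β, subdiff f x = realSubdiff v w a β x := fun x hx => by
    ext u
    rw [mem_subdiff_iff hP hT hne]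
    exact and_iff_right hx
  constructor
  · rintro hS x ⟨u, huA, hu⟩
    have hx := ((mem_subdiff_iff hP hT hne).mp hu).1
    rw [hsub x hx] at hu ⊢
    rw [mem_rowSpace_iff] at huA
    by_contra hlt
    obtain ⟨y, hy, hyx, hAy, hle⟩ := exists_ne_of_rank_lt A hx huA hu (by
      change ¬ n - Module.finrank ℝ (diffSpan (realSubdiff v w a β x)) ≤ A.rank at hlt
      omega)
    obtain ⟨z, rfl⟩ := huA
    obtain ⟨b, hb⟩ := (hD.2.2.2 (A.mulVec x)).2 (-z)
    have hmin : ∀ q ∈ polyhedron a β,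
        D (A.mulVec x) b + maxAffine v w x ≤ D (A.mulVec q) b + maxAffine v w q := by
      intro q hq
      have h1 := hD.gradient_le b (A.mulVec x) (A.mulVec q)
      have h2 := hu q hq
      simp only at hb
      rw [hb, ← Matrix.mulVec_sub, neg_dotProduct] at h1
      rw [Matrix.vecMulLinear_apply, ← Matrix.dotProduct_mulVec] at h2
      linarith
    refine hyx (hS b ((mem_solSet_iff hP hT hne).mpr ⟨hy, fun q hq => ?_⟩)
      ((mem_solSet_iff hP hT hne).mpr ⟨hx, hmin⟩))
    have := hmin q hq
    rw [hAy]
    linarith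
  · intro H b x hx y hy
    rw [mem_solSet_iff hP hT hne] at hx hy
    by_contra hxy
    obtain ⟨q, hq, hker, hu, hort⟩ := hD.midpoint_of_minimizers hx.1 hy.1 hx.2 hy.2
    obtain ⟨p, hp, ⟨u, huA, hup⟩, hlt⟩ := exists_rank_lt hspan A
      (sub_ne_zero.mpr (Ne.symm hxy)) hker _ q _ rfl hq ⟨_, rfl⟩ hu hort
    have := H p ⟨u, mem_rowSpace_iff.mpr huA, by rwa [hsub p hp]⟩
    rw [hsub p hp] at this
    change n - Module.finrank ℝ (diffSpan (realSubdiff v w a β p)) ≤ A.rank at this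
    omega

end
end

section
/- Let G be the simple graph on Fin N in which i and j are adjacent if and only if (i,j) ∈ E or (j,i) ∈ E. Then G is acyclic (contains no cycle, i.e., is a forest) if and only if for every sign assignment u : E → {−1, 1} the point z_u is an extreme point of the polytope P_TV. -/
noncomputable section

/-- The vector `d_{i,j} = e_i - e_j` associated to an oriented edge `p = (i, j)`. -/
def dvec {N : ℕ} (p : Fin N × Fin N) : Fin N → ℝ :=
  fun i => (if i = p.1 then (1 : ℝ) else 0) - (if i = p.2 then (1 : ℝ) else 0)

/-- The point `z_u = ∑_{(i,j) ∈ E} u_{(i,j)} d_{i,j}` associated to a sign assignment `u`. -/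
def zvec {N : ℕ} (E : Finset (Fin N × Fin N)) (u : Fin N × Fin N → ℝ) : Fin N → ℝ :=
  ∑ p ∈ E, u p • dvec p

/-- The polytope `P_TV`, the convex hull of all points `z_u` over sign assignments
`u : E → {-1, 1}`. -/
def PTV {N : ℕ} (E : Finset (Fin N × Fin N)) : Set (Fin N → ℝ) :=
  convexHull ℝ
    {z | ∃ u : Fin N × Fin N → ℝ, (∀ p ∈ E, u p = 1 ∨ u p = -1) ∧ z = zvec E u}

theorem dvec_ne_zero {N : ℕ} {p : Fin N × Fin N} (hp : p.1 ≠ p.2) : dvec p ≠ 0 := by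
  intro h
  simpa [dvec, hp] using congrFun h p.1

theorem sum_mul_dvec {N : ℕ} (f : Fin N → ℝ) (p : Fin N × Fin N) :
    ∑ x, f x * dvec p x = f p.1 - f p.2 := by
  simp [dvec, mul_sub, Finset.sum_sub_distrib]

/-- `zvec E` as a linear map in its coefficients. -/
def zvecLinear {N : ℕ} (E : Finset (Fin N × Fin N)) :
    (Fin N × Fin N → ℝ) →ₗ[ℝ] (Fin N → ℝ) where
  toFun := zvec E
  map_add' u v := by simp [zvec, add_smul, Finset.sum_add_distrib]
  map_smul' a u := by simp [zvec, mul_smul, Finset.smul_sum]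

theorem zvecLinear_apply {N : ℕ} (E : Finset (Fin N × Fin N)) (u : Fin N × Fin N → ℝ) :
    zvecLinear E u = zvec E u := rfl

theorem zvecLinear_single {N : ℕ} {E : Finset (Fin N × Fin N)} {p : Fin N × Fin N}
    (hp : p ∈ E) (a : ℝ) : zvecLinear E (Pi.single p a) = a • dvec p := by
  rw [zvecLinear_apply, zvec, Finset.sum_eq_single_of_mem p hp]
  · simp
  · intro q _ hq
    simp [hq]

/-- `P_TV` is the image of a cube under `zvecLinear E`. -/
theorem PTV_eq_image {N : ℕ} (E : Finset (Fin N × Fin N)) :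
    PTV E = zvecLinear E '' {w | ∀ p ∈ E, w p ∈ Set.Icc (-1 : ℝ) 1} := by
  have hcube : {w : Fin N × Fin N → ℝ | ∀ p ∈ E, w p ∈ Set.Icc (-1 : ℝ) 1} =
      convexHull ℝ ((E : Set (Fin N × Fin N)).pi fun _ => ({-1, 1} : Set ℝ)) := by
    rw [convexHull_pi]
    ext w
    simp [Set.mem_pi, convexHull_pair, segment_eq_Icc]
  rw [hcube, LinearMap.image_convexHull, PTV]
  congr 1
  ext z
  constructor
  · rintro ⟨u, hu, rfl⟩
    exact ⟨u, fun p hp => (hu p hp).symm, rfl⟩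
  · rintro ⟨u, hu, rfl⟩
    exact ⟨u, fun p hp => (hu p hp).symm, rfl⟩

/-- All points `z_u` are extreme as soon as the vectors `dvec p`, `p ∈ E`, satisfy no nontrivial
linear relation. -/
theorem zvec_mem_extremePoints {N : ℕ} {E : Finset (Fin N × Fin N)}
    (h : ∀ c, zvecLinear E c = 0 → ∀ p ∈ E, c p = 0) {u : Fin N × Fin N → ℝ}
    (hu : ∀ p ∈ E, u p = 1 ∨ u p = -1) : zvec E u ∈ (PTV E).extremePoints ℝ := by
  rw [PTV_eq_image, mem_extremePoints_iff_left]
  refine ⟨⟨u, fun p hp => ?_, rfl⟩, ?_⟩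
  · rcases hu p hp with h | h <;> simp [h]
  rintro _ ⟨v, hv, rfl⟩ _ ⟨w, hw, rfl⟩ ⟨a, b, ha, hb, hab, hz⟩
  rw [← zvecLinear_apply, ← map_smul, ← map_smul, ← map_add, ← sub_eq_zero, ← map_sub] at hz
  refine Finset.sum_congr rfl fun p hp => ?_
  congr 1
  have hc : a * v p + b * w p - u p = 0 := h _ hz p hp
  obtain ⟨hv1, hv2⟩ := hv p hp
  obtain ⟨hw1, hw2⟩ := hw p hp
  rcases hu p hp with h | h <;> rw [h] at hc ⊢ <;> nlinarith

/-- If all points `z_u` are extreme, then the vectors `dvec p`, `p ∈ E`, satisfy no nontrivial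
linear relation. -/
theorem eq_zero_of_zvec_mem_extremePoints {N : ℕ} {E : Finset (Fin N × Fin N)}
    (hE : ∀ p ∈ E, p.1 ≠ p.2)
    (h : ∀ u : Fin N × Fin N → ℝ, (∀ p ∈ E, u p = 1 ∨ u p = -1) →
      zvec E u ∈ (PTV E).extremePoints ℝ)
    {c : Fin N × Fin N → ℝ} (hc : zvecLinear E c = 0) {p : Fin N × Fin N} (hp : p ∈ E) :
    c p = 0 := by
  by_contra hcp
  have hM : 0 < ‖c‖ := norm_pos_iff.2 fun h0 => hcp (by simp [h0])
  set u : Fin N × Fin N → ℝ := fun q => if 0 ≤ c q then 1 else -1 with hu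
  set w : Fin N × Fin N → ℝ := u - ‖c‖⁻¹ • c with hw
  have hwu : zvecLinear E w = zvec E u := by
    rw [hw, map_sub, map_smul, hc, smul_zero, sub_zero, zvecLinear_apply]
  have hbound (q) : -1 ≤ ‖c‖⁻¹ * c q ∧ ‖c‖⁻¹ * c q ≤ 1 := by
    rw [← abs_le, abs_mul, abs_inv, abs_norm, inv_mul_le_one₀ hM]
    exact norm_le_pi_norm c q
  have hwI (q) : w q ∈ Set.Icc (-1 : ℝ) 1 := by
    have hq : w q = u q - ‖c‖⁻¹ * c q := rfl
    obtain ⟨h1, h2⟩ := hbound q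
    rw [hq, hu]
    dsimp only
    split_ifs with h0
    · have := mul_nonneg (inv_pos.2 hM).le h0
      constructor <;> linarith
    · have := mul_neg_of_pos_of_neg (inv_pos.2 hM) (not_le.1 h0)
      constructor <;> linarith
  have hwp : -1 < w p ∧ w p < 1 := by
    have hq : w p = u p - ‖c‖⁻¹ * c p := rfl
    obtain ⟨h1, h2⟩ := hbound p
    rw [hq, hu]
    dsimp only
    split_ifs with h0
    · have := mul_pos (inv_pos.2 hM) (h0.lt_of_ne' hcp)
      constructor <;> linarith
    · have := mul_neg_of_pos_of_neg (inv_pos.2 hM) (not_le.1 h0)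
      constructor <;> linarith
  have hmem (t : ℝ) (ht : w p + t ∈ Set.Icc (-1 : ℝ) 1) :
      zvec E u + t • dvec p ∈ PTV E := by
    rw [PTV_eq_image]
    refine ⟨w + Pi.single p t, fun q _ => ?_, by rw [map_add, hwu, zvecLinear_single hp]⟩
    rcases eq_or_ne q p with rfl | hq
    · simpa using ht
    · simpa [hq] using hwI q
  obtain ⟨δ, hδ, hδ1, hδ2⟩ : ∃ δ : ℝ, 0 < δ ∧ δ ≤ 1 - w p ∧ δ ≤ w p + 1 :=
    ⟨min (1 - w p) (w p + 1), lt_min (by linarith) (by linarith), min_le_left _ _,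
      min_le_right _ _⟩
  have hu1 (q) : u q = 1 ∨ u q = -1 := by
    simp only [hu]
    split_ifs <;> simp
  have hext := (mem_extremePoints_iff_left.1 (h u fun q _ => hu1 q)).2
    _ (hmem δ ⟨by linarith, by linarith⟩) _ (hmem (-δ) ⟨by linarith, by linarith⟩)
    ⟨1 / 2, 1 / 2, by norm_num, by norm_num, by norm_num, by module⟩
  rw [add_eq_left, smul_eq_zero] at hext
  exact hext.elim hδ.ne' (dvec_ne_zero (hE p hp))

/-- In a forest, the vectors `dvec p`, `p ∈ E`, satisfy no nontrivial linear relation. -/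
theorem eq_zero_of_isAcyclic {N : ℕ} {E : Finset (Fin N × Fin N)}
    (hE : ∀ p ∈ E, (p.2, p.1) ∉ E) {G : SimpleGraph (Fin N)} (hG : G.IsAcyclic)
    (hEG : ∀ p ∈ E, G.Adj p.1 p.2) {c : Fin N × Fin N → ℝ} (hc : zvecLinear E c = 0)
    {p : Fin N × Fin N} (hp : p ∈ E) : c p = 0 := by
  classical
  have hbr := SimpleGraph.isAcyclic_iff_forall_adj_isBridge.1 hG (hEG p hp)
  rw [SimpleGraph.isBridge_iff] at hbr
  set H := G.deleteEdges {s(p.1, p.2)} with hH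
  let f : Fin N → ℝ := fun x => if H.Reachable p.1 x then 1 else 0
  have hsum : ∑ q ∈ E, c q * (f q.1 - f q.2) = 0 := by
    calc ∑ q ∈ E, c q * (f q.1 - f q.2) = ∑ x, f x * zvecLinear E c x := by
          simp only [← sum_mul_dvec, zvecLinear_apply, zvec, Finset.sum_apply, Finset.mul_sum,
            Pi.smul_apply, smul_eq_mul]
          rw [Finset.sum_comm]
          exact Finset.sum_congr rfl fun _ _ => Finset.sum_congr rfl fun _ _ => by ring
      _ = 0 := by simp [hc]
  rw [Finset.sum_eq_single_of_mem p hp] at hsum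
  · simpa [f, hbr] using hsum
  · intro q hq hqp
    have hadj : H.Adj q.1 q.2 := by
      rw [hH, SimpleGraph.deleteEdges_adj]
      refine ⟨hEG q hq, fun h => ?_⟩
      rcases Sym2.eq_iff.1 h with ⟨h1, h2⟩ | ⟨h1, h2⟩
      · exact hqp (Prod.ext h1 h2)
      · exact hE p hp (by rwa [← h1, ← h2])
    have : H.Reachable p.1 q.1 ↔ H.Reachable p.1 q.2 :=
      ⟨fun h => h.trans hadj.reachable, fun h => h.trans hadj.symm.reachable⟩
    simp [f, this]

/-- If `x` and `y` are connected by edges other than `p`, then `e_x - e_y` is a combination of the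
vectors `dvec q`, `q ∈ E`, not involving `dvec p`. -/
theorem exists_zvecLinear_eq_of_reachable {N : ℕ} {E : Finset (Fin N × Fin N)}
    {G : SimpleGraph (Fin N)} (hG : ∀ a b : Fin N, G.Adj a b → (a, b) ∈ E ∨ (b, a) ∈ E)
    (p : Fin N × Fin N) {x y : Fin N}
    (h : (G.deleteEdges {s(p.1, p.2)}).Reachable x y) :
    ∃ c, c p = 0 ∧ zvecLinear E c = dvec (x, y) := by
  obtain ⟨W⟩ := h
  induction W with
  | nil => exact ⟨0, rfl, by ext; simp [dvec]⟩
  | @cons a b y hab _ ih =>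
    obtain ⟨c, hcp, hc⟩ := ih
    rw [SimpleGraph.deleteEdges_adj] at hab
    obtain ⟨hadj, hne⟩ := hab
    rcases hG a b hadj with hE | hE
    · refine ⟨Pi.single (a, b) 1 + c, ?_, ?_⟩
      · have : p ≠ (a, b) := by rintro rfl; exact hne rfl
        simp [hcp, this]
      · rw [map_add, zvecLinear_single hE, hc]
        ext
        simp [dvec]
    · refine ⟨Pi.single (b, a) (-1) + c, ?_, ?_⟩
      · have : p ≠ (b, a) := by rintro rfl; exact hne Sym2.eq_swap
        simp [hcp, this]
      · rw [map_add, zvecLinear_single hE, hc]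
        ext
        simp [dvec]

/-- If the vectors `dvec p`, `p ∈ E`, satisfy no nontrivial linear relation, then the graph is a
forest. -/
theorem isAcyclic_of_eq_zero {N : ℕ} {E : Finset (Fin N × Fin N)} {G : SimpleGraph (Fin N)}
    (hG : ∀ a b : Fin N, G.Adj a b → (a, b) ∈ E ∨ (b, a) ∈ E)
    (h : ∀ c, zvecLinear E c = 0 → ∀ p ∈ E, c p = 0) : G.IsAcyclic := by
  have key (p) (hp : p ∈ E) : G.IsBridge s(p.1, p.2) := by
    rw [SimpleGraph.isBridge_iff]
    intro hr
    obtain ⟨c, hcp, hc⟩ := exists_zvecLinear_eq_of_reachable hG p hr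
    have := h (Pi.single p 1 - c) (by rw [map_sub, zvecLinear_single hp, hc]; simp) p hp
    simp [hcp] at this
  rw [SimpleGraph.isAcyclic_iff_forall_adj_isBridge]
  intro a b hab
  rcases hG a b hab with hE | hE
  · exact key _ hE
  · rw [Sym2.eq_swap]
    exact key _ hE

/-- The underlying undirected graph is a forest if and only if every sign assignment
yields an extreme point of `P_TV`. -/
theorem forest_iff_all_zvec_extreme {N : ℕ} (hN : 1 ≤ N)
    (E : Finset (Fin N × Fin N)) (hE1 : ∀ p ∈ E, p.1 ≠ p.2)
    (hE2 : ∀ p ∈ E, (p.2, p.1) ∉ E) (G : SimpleGraph (Fin N))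
    (hG : ∀ a b : Fin N, G.Adj a b ↔ ((a, b) ∈ E ∨ (b, a) ∈ E)) :
    G.IsAcyclic ↔
      ∀ u : Fin N × Fin N → ℝ, (∀ p ∈ E, u p = 1 ∨ u p = -1) →
        zvec E u ∈ (PTV E).extremePoints ℝ := by
  constructor
  · intro h u hu
    refine zvec_mem_extremePoints (fun c hc p hp => ?_) hu
    exact eq_zero_of_isAcyclic hE2 h (fun q hq => (hG _ _).2 (.inl hq)) hc hp
  · intro h
    exact isAcyclic_of_eq_zero (fun a b => (hG a b).1) fun c hc p hp =>
      eq_zero_of_zvec_mem_extremePoints hE1 h hc hp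

end
end
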